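/- (Curvature (Wolfe-type) condition for the CG scaling with unit step.) Let f : ℝ^d → ℝ be twice continuously differentiable and satisfy Hessian directional smoothness with constant L₂ > 0. Let σ > 0, η ∈ (0, 1), and fix x with g = g(x) ≠ 0 such that ⟨g, H(x) g⟩ > σ‖g‖². If ‖g‖ ≤ 2σ²η/L₂, then the CG-scaled direction p = −s_CG g with s_CG = ‖g‖²/⟨g, H(x) g⟩ satisfies the curvature condition with unit step size: ⟨g(x + p), p⟩ ≥ η ⟨g(x), p⟩. -/

import Mathlib

open scoped RealInnerProductSpace

/-- The Hessian of `f` at `x`, as a continuous linear map. -/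
noncomputable def hessian {d : ℕ} (f : EuclideanSpace ℝ (Fin d) → ℝ)
    (x : EuclideanSpace ℝ (Fin d)) :
    EuclideanSpace ℝ (Fin d) →L[ℝ] EuclideanSpace ℝ (Fin d) :=
  fderiv ℝ (gradient f) x

/-- The gradient of a `C²` function on a Hilbert space is differentiable. -/
theorem ContDiff.differentiable_gradient {E : Type*} [NormedAddCommGroup E]
    [InnerProductSpace ℝ E] [CompleteSpace E] {f : E → ℝ} (hf : ContDiff ℝ 2 f) :
    Differentiable ℝ (gradient f) :=
  (InnerProductSpace.toDual ℝ E).symm.differentiable.comp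
    ((hf.fderiv_right (m := 1) (by norm_num)).differentiable (by norm_num))

/-- Second-order upper bound for the component of a vector field along `v`, on the ray from `x`
in direction `-v`, when its derivative varies at a linear rate on that ray. -/
theorem inner_sub_smul_le_of_norm_fderiv_sub_le {E : Type*} [NormedAddCommGroup E]
    [InnerProductSpace ℝ E] {V : E → E} (hV : Differentiable ℝ V) {x v : E} {M : ℝ}
    (hM : ∀ t : ℝ, 0 ≤ t → ‖fderiv ℝ V (x - t • v) - fderiv ℝ V x‖ ≤ t * M)
    {s : ℝ} (hs : 0 ≤ s) :
    ⟪v, V (x - s • v)⟫ ≤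
      ⟪v, V x⟫ - s * ⟪v, fderiv ℝ V x v⟫ + s ^ 2 / 2 * (M * ‖v‖ ^ 2) := by
  let ψ : ℝ → ℝ := fun t ↦
    ⟪v, V (x - t • v)⟫ + t * ⟪v, fderiv ℝ V x v⟫ - t ^ 2 / 2 * (M * ‖v‖ ^ 2)
  have hψ (t : ℝ) : HasDerivAt ψ
      (-⟪v, (fderiv ℝ V (x - t • v) - fderiv ℝ V x) v⟫ - t * (M * ‖v‖ ^ 2)) t := by
    have hray : HasDerivAt (fun t : ℝ ↦ x - t • v) (-v) t := by
      simpa using ((hasDerivAt_id t).smul_const v).const_sub x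
    have hinner : HasDerivAt (fun t : ℝ ↦ ⟪v, V (x - t • v)⟫)
        ⟪v, fderiv ℝ V (x - t • v) (-v)⟫ t := by
      simpa using (hasDerivAt_const t v).inner ℝ
        ((hV (x - t • v)).hasFDerivAt.comp_hasDerivAt t hray)
    have hlin := (hasDerivAt_id t).mul_const ⟪v, fderiv ℝ V x v⟫
    have hquad := ((hasDerivAt_pow 2 t).div_const 2).mul_const (M * ‖v‖ ^ 2)
    refine ((hinner.add hlin).sub hquad).congr_deriv ?_
    simp only [map_neg, inner_neg_right, sub_apply, inner_sub_right]
    push_cast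
    ring
  have hanti : AntitoneOn ψ (Set.Ici 0) := by
    refine antitoneOn_of_deriv_nonpos (convex_Ici 0)
      (fun t _ ↦ (hψ t).continuousAt.continuousWithinAt)
      (fun t _ ↦ (hψ t).differentiableAt.differentiableWithinAt) fun t ht ↦ ?_
    rw [(hψ t).deriv]
    have ht0 : 0 ≤ t := interior_subset ht
    have hbound : |⟪v, (fderiv ℝ V (x - t • v) - fderiv ℝ V x) v⟫| ≤ t * (M * ‖v‖ ^ 2) :=
      calc
        _ ≤ ‖v‖ * ‖(fderiv ℝ V (x - t • v) - fderiv ℝ V x) v‖ := abs_real_inner_le_norm _ _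
        _ ≤ ‖v‖ * (t * M * ‖v‖) := by
          gcongr
          exact ContinuousLinearMap.le_of_opNorm_le _ (hM t ht0) v
        _ = t * (M * ‖v‖ ^ 2) := by ring
    linarith [neg_le_of_abs_le hbound]
  have hle : ψ s ≤ ψ 0 := hanti Set.self_mem_Ici hs hs
  simp only [ψ, zero_smul, sub_zero, zero_mul, add_zero, ne_eq, OfNat.ofNat_ne_zero,
    not_false_eq_true, zero_pow, zero_div] at hle
  linarith

/-- The curvature (Wolfe-type) condition holds for the CG scaling with unit step. -/
theorem stmt_18 {d : ℕ} (f : EuclideanSpace ℝ (Fin d) → ℝ) (hf : ContDiff ℝ 2 f)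
    (L₂ : ℝ) (hL₂ : 0 < L₂)
    (hsmooth : ∀ x : EuclideanSpace ℝ (Fin d), ∀ t : ℝ, 0 ≤ t →
      ‖hessian f (x - t • gradient f x) - hessian f x‖ ≤ t * L₂ * ‖gradient f x‖)
    (σ η : ℝ) (hσ : 0 < σ) (hη : η ∈ Set.Ioo (0 : ℝ) 1)
    (x : EuclideanSpace ℝ (Fin d)) (hgx : gradient f x ≠ 0)
    (hSPC : σ * ‖gradient f x‖ ^ 2 <
      ⟪gradient f x, hessian f x (gradient f x)⟫)
    (hgnorm : ‖gradient f x‖ ≤ 2 * σ ^ 2 * η / L₂)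
    (s : ℝ) (hs : s = ‖gradient f x‖ ^ 2 /
      ⟪gradient f x, hessian f x (gradient f x)⟫)
    (p : EuclideanSpace ℝ (Fin d)) (hp : p = -(s • gradient f x)) :
    η * ⟪gradient f x, p⟫ ≤ ⟪gradient f (x + p), p⟫ := by
  have hG : 0 < ‖gradient f x‖ := norm_pos_iff.mpr hgx
  have hc : 0 < ⟪gradient f x, hessian f x (gradient f x)⟫ := lt_trans (by positivity) hSPC
  have hs0 : 0 < s := by rw [hs]; positivity
  have hsc : s * ⟪gradient f x, hessian f x (gradient f x)⟫ = ‖gradient f x‖ ^ 2 := by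
    rw [hs]; field_simp
  have hsσ : s * σ ≤ 1 := by
    rw [hs, div_mul_eq_mul_div, div_le_one hc]
    linarith
  have hray := inner_sub_smul_le_of_norm_fderiv_sub_le hf.differentiable_gradient
    (v := gradient f x) (M := L₂ * ‖gradient f x‖)
    (fun t ht ↦ (hsmooth x t ht).trans_eq (mul_assoc _ _ _)) hs0.le
  change _ ≤ _ - s * ⟪gradient f x, hessian f x (gradient f x)⟫ + _ at hray
  rw [hsc, real_inner_self_eq_norm_sq, sub_self, zero_add] at hray
  have hLG : L₂ * ‖gradient f x‖ ≤ 2 * σ ^ 2 * η := by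
    rw [le_div_iff₀ hL₂] at hgnorm
    linarith
  have hcoef : s ^ 2 / 2 * (L₂ * ‖gradient f x‖) ≤ η :=
    calc
      _ ≤ s ^ 2 / 2 * (2 * σ ^ 2 * η) := by gcongr
      _ = (s * σ) ^ 2 * η := by ring
      _ ≤ 1 * η := by
        gcongr
        · exact hη.1.le
        · exact pow_le_one₀ (by positivity) hsσ
      _ = η := one_mul η
  have hcurv : ⟪gradient f x, gradient f (x - s • gradient f x)⟫ ≤ η * ‖gradient f x‖ ^ 2 :=
    calc
      _ ≤ s ^ 2 / 2 * (L₂ * ‖gradient f x‖) * ‖gradient f x‖ ^ 2 := by linarith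
      _ ≤ η * ‖gradient f x‖ ^ 2 := by gcongr
  rw [hp, ← sub_eq_add_neg, inner_neg_right, inner_neg_right, real_inner_smul_right,
    real_inner_smul_right, real_inner_self_eq_norm_sq, real_inner_comm]
  linarith [mul_le_mul_of_nonneg_left hcurv hs0.le]
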